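/- (Cluster self-testing theorem) Let N ≥ 2 and let {S_1,…,S_k} be a partition of {1,…,N} into k nonempty disjoint clusters, with k ≥ 2. For each cluster j let M^{(j)}_u be a binary observable on ℂ^{d_j} for every input string u ∈ {0,1}^{|S_j|}, and let ψ be a unit vector in ℂ^{d_1}⊗…⊗ℂ^{d_k} such that ⟨ψ, Ŝ_N^+ ψ⟩ = 2^{N−1}√2, where Ŝ_N^+ = Σ_{x ∈ {0,1}^N} (−1)^{w(x)(w(x)+1)/2} M^{(1)}_{x|_{S_1}} ⊗ … ⊗ M^{(k)}_{x|_{S_k}}. Then there exist natural numbers m_1,…,m_k, linear isometries V_j : ℂ^{d_j} → ℂ² ⊗ ℂ^{m_j}, and a unit vector ζ ∈ ℂ^{m_1}⊗…⊗ℂ^{m_k} such that, under the canonical reordering of tensor factors, (V_1 ⊗ … ⊗ V_k) ψ = Φ^k ⊗ ζ, where Φ^k = (|0⟩^{⊗k} + |1⟩^{⊗k})/√2 is the k-partite GHZ state shared among the clusters. -/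

import Mathlib

open Matrix

noncomputable section

/-- Hamming weight of a bit string. -/
def wt {n : ℕ} (x : Fin n → Fin 2) : ℕ := ∑ i, (x i : ℕ)

/-- The Svetlichny sign `(-1)^{w(x)(w(x)+1)/2}`. -/
def sgn {n : ℕ} (x : Fin n → Fin 2) : ℂ := (-1) ^ (wt x * (wt x + 1) / 2)

/-- The Svetlichny–Bell operator
`Ŝ_N^+ = Σ_x (-1)^{w(x)(w(x)+1)/2} M^{(1)}_{x|_{S_1}} ⊗ ⋯ ⊗ M^{(k)}_{x|_{S_k}}` in the cluster
scenario, where the cluster of party `i` is `B i` and `x|_{S_j}` is the restriction of the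
input string `x` to the members of cluster `j`. -/
def svetOpCluster {N k : ℕ} (B : Fin N → Fin k) {d : Fin k → ℕ}
    (M : (j : Fin k) → (({ i // B i = j }) → Fin 2) → Matrix (Fin (d j)) (Fin (d j)) ℂ) :
    Matrix ((j : Fin k) → Fin (d j)) ((j : Fin k) → Fin (d j)) ℂ :=
  ∑ x : Fin N → Fin 2,
    sgn x • (Matrix.of fun p q => ∏ j, M j (fun i => x i.1) (p j) (q j))

/-- The GHZ state `(|0…0⟩ + |1…1⟩)/√2` on the qubits indexed by `α`. -/
def ghzVec {α : Type*} [Fintype α] [DecidableEq α] : (α → Fin 2) → ℂ :=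
  fun b => ((if b = fun _ => 0 then 1 else 0) + (if b = fun _ => 1 then 1 else 0)) /
    (Real.sqrt 2 : ℂ)

/-- The action of the tensor product `V_1 ⊗ ⋯ ⊗ V_k` of the cluster isometries
`V_j : ℂ^{d j} → ℂ² ⊗ ℂ^{m j}` on a state `ψ`, written in components. -/
def tensorIsoAct {k : ℕ} {d m : Fin k → ℕ}
    (V : (j : Fin k) → Matrix (Fin 2 × Fin (m j)) (Fin (d j)) ℂ)
    (ψ : ((j : Fin k) → Fin (d j)) → ℂ) :
    ((j : Fin k) → Fin 2 × Fin (m j)) → ℂ :=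
  fun f => ∑ x : (j : Fin k) → Fin (d j), (∏ j, V j (f j) (x j)) * ψ x

section TensorProduct

variable {ι : Type*} [Fintype ι] {n : ι → Type*}

/-- The Kronecker product of a finite family of square matrices. -/
def piKronecker (X : (j : ι) → Matrix (n j) (n j) ℂ) :
    Matrix ((j : ι) → n j) ((j : ι) → n j) ℂ :=
  Matrix.of fun p q => ∏ j, X j (p j) (q j)

theorem piKronecker_conjTranspose (X : (j : ι) → Matrix (n j) (n j) ℂ) :
    (piKronecker X)ᴴ = piKronecker fun j => (X j)ᴴ := by
  ext p q
  simp [piKronecker, conjTranspose_apply]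

theorem piKronecker_smul (a : ι → ℂ) (X : (j : ι) → Matrix (n j) (n j) ℂ) :
    piKronecker (fun j => a j • X j) = (∏ j, a j) • piKronecker X := by
  ext p q
  simp [piKronecker, Finset.prod_mul_distrib]

theorem piKronecker_sum [DecidableEq ι] {β : Type*} [Fintype β]
    (X : (j : ι) → β → Matrix (n j) (n j) ℂ) :
    piKronecker (fun j => ∑ b, X j b) = ∑ z : ι → β, piKronecker fun j => X j (z j) := by
  ext p q
  simp only [piKronecker, Matrix.of_apply, Matrix.sum_apply]
  rw [Finset.prod_univ_sum, Fintype.piFinset_univ]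

theorem piKronecker_mul [DecidableEq ι] [∀ j, Fintype (n j)]
    (X Y : (j : ι) → Matrix (n j) (n j) ℂ) :
    piKronecker X * piKronecker Y = piKronecker fun j => X j * Y j := by
  ext p q
  simp only [piKronecker, Matrix.mul_apply, Matrix.of_apply]
  rw [Finset.prod_univ_sum, Fintype.piFinset_univ]
  simp [Finset.prod_mul_distrib]

variable [∀ j, DecidableEq (n j)]

theorem piKronecker_one : piKronecker (1 : (j : ι) → Matrix (n j) (n j) ℂ) = 1 := by
  ext p q
  simp only [piKronecker, Matrix.of_apply, Pi.one_apply, Matrix.one_apply]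
  by_cases h : p = q
  · simp [h]
  · rw [if_neg h]
    obtain ⟨j, hj⟩ := Function.ne_iff.mp h
    exact Finset.prod_eq_zero (Finset.mem_univ j) (if_neg hj)

variable [DecidableEq ι]

/-- The operator acting as `X` on the `j`-th tensor factor and trivially on the others. -/
def localOp (j : ι) (X : Matrix (n j) (n j) ℂ) : Matrix ((j : ι) → n j) ((j : ι) → n j) ℂ :=
  piKronecker (Function.update 1 j X)

theorem localOp_one (j : ι) : localOp j (1 : Matrix (n j) (n j) ℂ) = 1 := by
  have : Function.update (1 : (j : ι) → Matrix (n j) (n j) ℂ) j 1 = 1 :=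
    Function.update_eq_self j (1 : (j : ι) → Matrix (n j) (n j) ℂ)
  rw [localOp, this, piKronecker_one]

theorem localOp_conjTranspose (j : ι) (X : Matrix (n j) (n j) ℂ) :
    (localOp j X)ᴴ = localOp j Xᴴ := by
  rw [localOp, localOp, piKronecker_conjTranspose]
  congr 1
  funext i
  rcases eq_or_ne i j with rfl | h
  · simp
  · simp [h]

theorem localOp_add (j : ι) (X Y : Matrix (n j) (n j) ℂ) :
    localOp j (X + Y) = localOp j X + localOp j Y := by
  ext p q
  simp only [localOp, piKronecker, Matrix.of_apply, Matrix.add_apply]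
  simp only [← Finset.mul_prod_erase Finset.univ _ (Finset.mem_univ j), Function.update_self,
    Matrix.add_apply, add_mul]
  congr 2 <;>
  · refine Finset.prod_congr rfl fun i hi => ?_
    simp [Finset.ne_of_mem_erase hi]

variable [∀ j, Fintype (n j)]

theorem localOp_mul (j : ι) (X Y : Matrix (n j) (n j) ℂ) :
    localOp j X * localOp j Y = localOp j (X * Y) := by
  rw [localOp, localOp, localOp, piKronecker_mul]
  congr 1
  funext i
  rcases eq_or_ne i j with rfl | h
  · simp
  · simp [h]

theorem localOp_comm {i j : ι} (h : i ≠ j) (X : Matrix (n i) (n i) ℂ) (Y : Matrix (n j) (n j) ℂ) :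
    localOp i X * localOp j Y = localOp j Y * localOp i X := by
  rw [localOp, localOp, piKronecker_mul, piKronecker_mul]
  congr 1
  funext l
  rcases eq_or_ne l i with rfl | h1
  · simp [h]
  · simp [h1]

theorem piKronecker_eq_localOp_mul (j : ι) (X : (j : ι) → Matrix (n j) (n j) ℂ) :
    piKronecker X = localOp j (X j) * piKronecker (Function.update X j 1) := by
  rw [localOp, piKronecker_mul]
  congr 1
  funext i
  rcases eq_or_ne i j with rfl | h
  · simp
  · simp [h]

theorem piKronecker_eq_mul_localOp (j : ι) (X : (j : ι) → Matrix (n j) (n j) ℂ) :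
    piKronecker X = piKronecker (Function.update X j 1) * localOp j (X j) := by
  rw [localOp, piKronecker_mul]
  congr 1
  funext i
  rcases eq_or_ne i j with rfl | h
  · simp
  · simp [h]

theorem localOp_comm_piKronecker (j : ι) (X : (j : ι) → Matrix (n j) (n j) ℂ) (hX : X j = 1)
    (Y : Matrix (n j) (n j) ℂ) :
    localOp j Y * piKronecker X = piKronecker X * localOp j Y := by
  rw [localOp, piKronecker_mul, piKronecker_mul]
  congr 1
  funext i
  rcases eq_or_ne i j with rfl | h
  · simp [hX]
  · simp [h]

/-- A property of products of local operators, by induction on the number of factors. -/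
theorem piKronecker_induction (X : (j : ι) → Matrix (n j) (n j) ℂ)
    (P : Matrix ((j : ι) → n j) ((j : ι) → n j) ℂ → Prop) (h1 : P 1)
    (hmul : ∀ j Y, P Y → P (localOp j (X j) * Y)) : P (piKronecker X) := by
  have key : ∀ s : Finset ι, P (piKronecker fun j => if j ∈ s then X j else 1) := by
    intro s
    induction s using Finset.induction_on with
    | empty =>
      have := piKronecker_one (n := n)
      simp only [Finset.notMem_empty, if_false]
      exact this ▸ h1
    | insert a s ha ih =>
      have := hmul a _ ih
      rw [localOp, piKronecker_mul] at this
      convert this using 2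
      funext i
      rcases eq_or_ne i a with rfl | h
      · simp [ha]
      · simp [h]
  simpa using key Finset.univ

theorem piKronecker_mulVec_congr (X Y : (j : ι) → Matrix (n j) (n j) ℂ) (φ : ((j : ι) → n j) → ℂ)
    (h : ∀ j, localOp j (X j) *ᵥ φ = localOp j (Y j) *ᵥ φ) :
    piKronecker X *ᵥ φ = piKronecker Y *ᵥ φ := by
  have key : ∀ s : Finset ι,
      piKronecker (fun j => if j ∈ s then X j else Y j) *ᵥ φ = piKronecker Y *ᵥ φ := by
    intro s
    induction s using Finset.induction_on with
    | empty => simp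
    | insert a s ha ih =>
      rw [← ih, piKronecker_eq_mul_localOp a, piKronecker_eq_mul_localOp a
        (fun j => if j ∈ s then X j else Y j), ← mulVec_mulVec, ← mulVec_mulVec]
      simp only [Finset.mem_insert_self, if_true, ha, if_false, h]
      congr 2
      funext i
      rcases eq_or_ne i a with rfl | h
      · simp
      · simp [h]
  simpa using key Finset.univ

end TensorProduct

section Ladder

variable {I : Type*} [Fintype I]

/-- The squared Euclidean norm of a vector of complex amplitudes. -/
def vecNormSq (v : I → ℂ) : ℝ := (star v ⬝ᵥ v).re

theorem vecNormSq_eq_sum (v : I → ℂ) : vecNormSq v = ∑ x, ‖v x‖ ^ 2 := by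
  simp [vecNormSq, dotProduct, Complex.conj_mul', ← Complex.ofReal_pow]

theorem vecNormSq_nonneg (v : I → ℂ) : 0 ≤ vecNormSq v := by
  rw [vecNormSq_eq_sum]
  positivity

theorem eq_zero_of_vecNormSq_le_zero {v : I → ℂ} (h : vecNormSq v ≤ 0) : v = 0 := by
  rw [vecNormSq_eq_sum] at h
  have h0 : ∑ x, ‖v x‖ ^ 2 = 0 := le_antisymm h (by positivity)
  rw [Finset.sum_eq_zero_iff_of_nonneg fun _ _ => by positivity] at h0
  funext x
  simpa using h0 x (Finset.mem_univ x)

theorem star_mulVec_dotProduct (X : Matrix I I ℂ) (u v : I → ℂ) :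
    star (X *ᵥ u) ⬝ᵥ v = star u ⬝ᵥ (Xᴴ *ᵥ v) := by
  rw [star_mulVec, dotProduct_mulVec]

theorem vecNormSq_mulVec (X : Matrix I I ℂ) (v : I → ℂ) :
    vecNormSq (X *ᵥ v) = (star v ⬝ᵥ ((Xᴴ * X) *ᵥ v)).re := by
  rw [vecNormSq, star_mulVec_dotProduct, mulVec_mulVec]

theorem vecNormSq_sub (u v : I → ℂ) :
    vecNormSq (u - v) = vecNormSq u + vecNormSq v - 2 * (star u ⬝ᵥ v).re := by
  have h : (star v ⬝ᵥ u).re = (star u ⬝ᵥ v).re := by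
    rw [← Complex.conj_re, ← Complex.star_def, star_dotProduct, star_star]
  simp only [vecNormSq, star_sub, sub_dotProduct, dotProduct_sub, Complex.sub_re]
  rw [h]
  ring

theorem vecNormSq_smul {c : ℂ} (hc : star c * c = 1) (v : I → ℂ) :
    vecNormSq (c • v) = vecNormSq v := by
  rw [vecNormSq, star_smul, smul_dotProduct, dotProduct_smul, smul_smul, hc, one_smul, vecNormSq]

variable [DecidableEq I]

/-- The algebraic relations satisfied by `(A + i B) / 2` for binary observables `A`, `B`. -/
structure IsLadder (D : Matrix I I ℂ) : Prop where
  mul_add_mul : D * Dᴴ + Dᴴ * D = 1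
  sq_add_sq : D * D + Dᴴ * Dᴴ = 0

namespace IsLadder

variable {D a b R : Matrix I I ℂ}

theorem conjTranspose (h : IsLadder D) : IsLadder Dᴴ where
  mul_add_mul := by rw [conjTranspose_conjTranspose, add_comm, h.mul_add_mul]
  sq_add_sq := by rw [conjTranspose_conjTranspose, add_comm, h.sq_add_sq]

theorem vecNormSq_add (h : IsLadder D) (v : I → ℂ) :
    vecNormSq (D *ᵥ v) + vecNormSq (Dᴴ *ᵥ v) = vecNormSq v := by
  rw [vecNormSq_mulVec, vecNormSq_mulVec, conjTranspose_conjTranspose, ← Complex.add_re,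
    ← dotProduct_add, ← add_mulVec, add_comm, h.mul_add_mul, one_mulVec, vecNormSq]

theorem vecNormSq_mulVec_le (h : IsLadder D) (v : I → ℂ) : vecNormSq (D *ᵥ v) ≤ vecNormSq v := by
  linarith [h.vecNormSq_add v, vecNormSq_nonneg (Dᴴ *ᵥ v)]

theorem mulVec_sq_eq_zero (h : IsLadder D) {v : I → ℂ} (hv : Dᴴ *ᵥ Dᴴ *ᵥ v = 0) :
    D *ᵥ D *ᵥ v = 0 := by
  have := congrArg (· *ᵥ v) h.sq_add_sq
  simpa [add_mulVec, ← mulVec_mulVec, hv] using this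

theorem conjTranspose_mul_self_mulVec (h : IsLadder D) {v : I → ℂ} (hv : Dᴴ *ᵥ v = 0) :
    Dᴴ *ᵥ D *ᵥ v = v := by
  have := congrArg (· *ᵥ v) h.mul_add_mul
  simpa [add_mulVec, ← mulVec_mulVec, hv] using this

/-- The sum-of-squares decomposition behind the bound `Re (ω ⟨ψ, a R b ψ⟩) ≤ 1 / 2`. -/
theorem sum_of_squares (ha : IsLadder a) (hb : IsLadder b) (hab : a * b = b * a)
    (haR : a * R = R * a) (hbR : b * R = R * b) {ω : ℂ} (hω : star ω * ω = 1) (ψ : I → ℂ) :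
    4 * (ω * (star ψ ⬝ᵥ ((a * R * b) *ᵥ ψ))).re
      + vecNormSq (aᴴ *ᵥ ψ - ω • R *ᵥ b *ᵥ ψ)
      + vecNormSq (a *ᵥ ψ - star ω • Rᴴ *ᵥ bᴴ *ᵥ ψ)
      + (vecNormSq (b *ᵥ ψ) - vecNormSq (R *ᵥ b *ᵥ ψ))
      + (vecNormSq (bᴴ *ᵥ ψ) - vecNormSq (Rᴴ *ᵥ bᴴ *ᵥ ψ)) = 2 * vecNormSq ψ := by
  have hω' : star (star ω) * star ω = 1 := by rw [star_star, mul_comm, hω]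
  have h1 : star (aᴴ *ᵥ ψ) ⬝ᵥ (ω • R *ᵥ b *ᵥ ψ) = ω * (star ψ ⬝ᵥ ((a * R * b) *ᵥ ψ)) := by
    rw [star_mulVec_dotProduct, conjTranspose_conjTranspose, mulVec_smul, dotProduct_smul,
      mulVec_mulVec, mulVec_mulVec, mul_assoc, smul_eq_mul]
  have h2 : star (a *ᵥ ψ) ⬝ᵥ (star ω • Rᴴ *ᵥ bᴴ *ᵥ ψ)
      = star (ω * (star ψ ⬝ᵥ ((a * R * b) *ᵥ ψ))) := by
    have hT : aᴴ * (Rᴴ * bᴴ) = (a * R * b)ᴴ := by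
      rw [← conjTranspose_mul, ← conjTranspose_mul, mul_assoc a, ← hbR, mul_assoc, ← haR,
        ← mul_assoc, ← hab, mul_assoc]
    rw [star_mulVec_dotProduct, mulVec_smul, dotProduct_smul, mulVec_mulVec, mulVec_mulVec, mul_assoc aᴴ, hT,
      ← star_mulVec_dotProduct, star_mul', smul_eq_mul, star_dotProduct _ ψ]
  rw [vecNormSq_sub, vecNormSq_sub, h1, h2, vecNormSq_smul hω, vecNormSq_smul hω', Complex.star_def,
    Complex.conj_re]
  linarith [ha.vecNormSq_add ψ, hb.vecNormSq_add ψ]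

end IsLadder

end Ladder

theorem ladder_or_one_update {ι : Type*} [DecidableEq ι] {n : ι → Type*} [∀ j, Fintype (n j)]
    [∀ j, DecidableEq (n j)] {X : (j : ι) → Matrix (n j) (n j) ℂ} (hX : ∀ j, IsLadder (X j) ∨ X j = 1)
    (i l : ι) :
    IsLadder (Function.update X i 1 l) ∨ Function.update X i 1 l = 1 := by
  rcases eq_or_ne l i with rfl | h
  · simp
  · simpa [h] using hX l

section SelfTest

variable {ι : Type*} [Fintype ι] [DecidableEq ι] {n : ι → Type*} [∀ j, Fintype (n j)]
  [∀ j, DecidableEq (n j)]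

theorem isLadder_localOp (j : ι) {D : Matrix (n j) (n j) ℂ} (h : IsLadder D) :
    IsLadder (localOp j D) where
  mul_add_mul := by
    rw [localOp_conjTranspose, localOp_mul, localOp_mul, ← localOp_add, h.mul_add_mul, localOp_one]
  sq_add_sq := by
    have h0 : localOp j (0 : Matrix (n j) (n j) ℂ) = 0 := by
      simpa using localOp_add j (0 : Matrix (n j) (n j) ℂ) 0
    rw [localOp_conjTranspose, localOp_mul, localOp_mul, ← localOp_add, h.sq_add_sq, h0]

theorem vecNormSq_piKronecker_mulVec_le (X : (j : ι) → Matrix (n j) (n j) ℂ)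
    (hX : ∀ j, IsLadder (X j) ∨ X j = 1) (v : ((j : ι) → n j) → ℂ) :
    vecNormSq (piKronecker X *ᵥ v) ≤ vecNormSq v := by
  refine piKronecker_induction X (fun Y => vecNormSq (Y *ᵥ v) ≤ vecNormSq v) (by simp) ?_
  intro j Y hY
  rw [← mulVec_mulVec]
  rcases hX j with h | h
  · exact ((isLadder_localOp j h).vecNormSq_mulVec_le _).trans hY
  · rwa [h, localOp_one, one_mulVec]

/-- The tensor product of `D` over all factors except `i` and `j`. -/
def restOp (D : (j : ι) → Matrix (n j) (n j) ℂ) (i j : ι) :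
    Matrix ((j : ι) → n j) ((j : ι) → n j) ℂ :=
  piKronecker (Function.update (Function.update D i 1) j 1)

variable {D : (j : ι) → Matrix (n j) (n j) ℂ} {i j : ι}

theorem localOp_mul_restOp_mul (hij : i ≠ j) :
    localOp i (D i) * restOp D i j * localOp j (D j) = piKronecker D := by
  rw [piKronecker_eq_localOp_mul i D, piKronecker_eq_mul_localOp j (Function.update D i 1),
    Function.update_of_ne hij.symm, restOp, mul_assoc]

theorem localOp_comm_restOp_left (i j : ι) (X : Matrix (n i) (n i) ℂ) :
    localOp i X * restOp D i j = restOp D i j * localOp i X :=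
  localOp_comm_piKronecker i _ (by rcases eq_or_ne i j with rfl | h <;> simp [*]) X

theorem localOp_comm_restOp_right (i j : ι) (X : Matrix (n j) (n j) ℂ) :
    localOp j X * restOp D i j = restOp D i j * localOp j X :=
  localOp_comm_piKronecker j _ (by simp) X

theorem vecNormSq_restOp_le (hD : ∀ j, IsLadder (D j)) (i j : ι) (v : ((j : ι) → n j) → ℂ) :
    vecNormSq (restOp D i j *ᵥ v) ≤ vecNormSq v :=
  vecNormSq_piKronecker_mulVec_le _
    (ladder_or_one_update (ladder_or_one_update (fun l => Or.inl (hD l)) i) j) v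

theorem vecNormSq_restOp_conjTranspose_le (hD : ∀ j, IsLadder (D j)) (i j : ι)
    (v : ((j : ι) → n j) → ℂ) :
    vecNormSq ((restOp D i j)ᴴ *ᵥ v) ≤ vecNormSq v := by
  rw [restOp, piKronecker_conjTranspose]
  refine vecNormSq_piKronecker_mulVec_le _ (fun l => ?_) v
  rcases ladder_or_one_update (ladder_or_one_update (fun l => Or.inl (hD l)) i) j l with h | h
  · exact Or.inl h.conjTranspose
  · exact Or.inr (by rw [h, conjTranspose_one])

variable {ω : ℂ} {ψ : ((j : ι) → n j) → ℂ}

theorem re_piKronecker_le (hD : ∀ j, IsLadder (D j)) (hij : i ≠ j) (hω : star ω * ω = 1)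
    (hψ : vecNormSq ψ = 1) : (ω * (star ψ ⬝ᵥ (piKronecker D *ᵥ ψ))).re ≤ 1 / 2 := by
  have := (isLadder_localOp i (hD i)).sum_of_squares (isLadder_localOp j (hD j))
    (localOp_comm hij _ _) (localOp_comm_restOp_left (D := D) i j _)
    (localOp_comm_restOp_right (D := D) i j _) hω ψ
  rw [localOp_mul_restOp_mul hij, hψ] at this
  linarith [vecNormSq_restOp_le hD i j (localOp j (D j) *ᵥ ψ),
    vecNormSq_restOp_conjTranspose_le hD i j ((localOp j (D j))ᴴ *ᵥ ψ),
    vecNormSq_nonneg ((localOp i (D i))ᴴ *ᵥ ψ - ω • restOp D i j *ᵥ localOp j (D j) *ᵥ ψ),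
    vecNormSq_nonneg (localOp i (D i) *ᵥ ψ -
      star ω • (restOp D i j)ᴴ *ᵥ (localOp j (D j))ᴴ *ᵥ ψ)]

/-- The relations forced on a state that saturates `re_piKronecker_le`. -/
theorem saturation (hD : ∀ j, IsLadder (D j)) (hij : i ≠ j) (hω : star ω * ω = 1)
    (hψ : vecNormSq ψ = 1) (hmax : (ω * (star ψ ⬝ᵥ (piKronecker D *ᵥ ψ))).re = 1 / 2) :
    (localOp i (D i))ᴴ *ᵥ ψ = ω • restOp D i j *ᵥ localOp j (D j) *ᵥ ψ ∧
    localOp i (D i) *ᵥ ψ = star ω • (restOp D i j)ᴴ *ᵥ (localOp j (D j))ᴴ *ᵥ ψ ∧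
    vecNormSq (localOp j (D j) *ᵥ ψ) ≤ vecNormSq (restOp D i j *ᵥ localOp j (D j) *ᵥ ψ) := by
  have := (isLadder_localOp i (hD i)).sum_of_squares (isLadder_localOp j (hD j))
    (localOp_comm hij _ _) (localOp_comm_restOp_left (D := D) i j _)
    (localOp_comm_restOp_right (D := D) i j _) hω ψ
  rw [localOp_mul_restOp_mul hij, hψ, hmax] at this
  have h1 := vecNormSq_restOp_le hD i j (localOp j (D j) *ᵥ ψ)
  have h2 := vecNormSq_restOp_conjTranspose_le hD i j ((localOp j (D j))ᴴ *ᵥ ψ)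
  have h3 := vecNormSq_nonneg
    ((localOp i (D i))ᴴ *ᵥ ψ - ω • restOp D i j *ᵥ localOp j (D j) *ᵥ ψ)
  have h4 := vecNormSq_nonneg (localOp i (D i) *ᵥ ψ -
      star ω • (restOp D i j)ᴴ *ᵥ (localOp j (D j))ᴴ *ᵥ ψ)
  refine ⟨sub_eq_zero.mp (eq_zero_of_vecNormSq_le_zero ?_),
    sub_eq_zero.mp (eq_zero_of_vecNormSq_le_zero ?_), ?_⟩ <;> linarith

theorem conjTranspose_mulVec_mulVec_eq_zero (hD : ∀ j, IsLadder (D j)) (hij : i ≠ j)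
    (hω : star ω * ω = 1) (hωI : ω * ω = Complex.I) (hψ : vecNormSq ψ = 1)
    (hmax : (ω * (star ψ ⬝ᵥ (piKronecker D *ᵥ ψ))).re = 1 / 2) :
    (localOp i (D i))ᴴ *ᵥ localOp j (D j) *ᵥ ψ = 0 := by
  by_cases hl : ∃ l, l ≠ i ∧ l ≠ j
  · obtain ⟨l, hli, hlj⟩ := hl
    obtain ⟨-, -, h⟩ := saturation hD hlj hω hψ hmax
    have hX : Function.update (Function.update D l 1) j 1 i = D i := by simp [hij, hli.symm]
    rw [restOp, piKronecker_eq_mul_localOp i, hX, ← mulVec_mulVec] at h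
    have h' := vecNormSq_piKronecker_mulVec_le
      (Function.update (Function.update (Function.update D l 1) j 1) i 1)
      (ladder_or_one_update (ladder_or_one_update
        (ladder_or_one_update (fun l => Or.inl (hD l)) l) j) i)
      (localOp i (D i) *ᵥ localOp j (D j) *ᵥ ψ)
    apply eq_zero_of_vecNormSq_le_zero
    linarith [(isLadder_localOp i (hD i)).vecNormSq_add (localOp j (D j) *ᵥ ψ)]
  · have hR : restOp D i j = 1 := by
      rw [restOp, ← piKronecker_one]
      congr 1
      funext l
      rcases eq_or_ne l j with rfl | h1
      · simp
      · rcases eq_or_ne l i with rfl | h2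
        · simp [h1]
        · exact absurd ⟨l, h2, h1⟩ hl
    obtain ⟨h1, h2, -⟩ := saturation hD hij hω hψ hmax
    have hc := localOp_comm hij (D i) (D j)
    have hc1 := localOp_comm hij (D i)ᴴ (D j)
    have hc2 := localOp_comm hij (D i) (D j)ᴴ
    have hai := (isLadder_localOp i (hD i)).sq_add_sq
    have haj := (isLadder_localOp j (hD j)).sq_add_sq
    rw [← localOp_conjTranspose] at hc1 hc2
    rw [hR] at h1 h2
    set a := localOp i (D i)
    set b := localOp j (D j)
    rw [one_mulVec] at h1
    rw [conjTranspose_one, one_mulVec] at h2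
    have e1 : (aᴴ * aᴴ) *ᵥ ψ = Complex.I • (b * b) *ᵥ ψ := by
      rw [← mulVec_mulVec, h1, mulVec_smul, mulVec_mulVec, hc1, ← mulVec_mulVec, h1, mulVec_smul,
        smul_smul, hωI, mulVec_mulVec]
    have e2 : (a * a) *ᵥ ψ = star Complex.I • (bᴴ * bᴴ) *ᵥ ψ := by
      rw [← mulVec_mulVec, h2, mulVec_smul, mulVec_mulVec, hc2, ← mulVec_mulVec, h2, mulVec_smul,
        smul_smul, ← hωI, star_mul', mulVec_mulVec]
    have e3 : (bᴴ * bᴴ) *ᵥ ψ = -((b * b) *ᵥ ψ) := by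
      rw [← neg_mulVec, eq_neg_of_add_eq_zero_right haj]
    have e4 : (aᴴ * aᴴ) *ᵥ ψ = -((a * a) *ᵥ ψ) := by
      rw [← neg_mulVec, eq_neg_of_add_eq_zero_right hai]
    have e5 : (aᴴ * aᴴ) *ᵥ ψ = 0 := by
      have : (aᴴ * aᴴ) *ᵥ ψ = -((aᴴ * aᴴ) *ᵥ ψ) := by
        conv_lhs => rw [e4, e2, e3]
        rw [e1]
        simp
      exact self_eq_neg.mp this
    have hω0 : ω ≠ 0 := by
      rintro rfl
      simp at hω
    rw [← mulVec_mulVec, h1, mulVec_smul] at e5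
    exact (smul_eq_zero.mp e5).resolve_left hω0

/-- The components of the isometry attached to a ladder operator `D`: the operator `Dᴴ` on `|0⟩`,
and `γ (D + Dᴴ) D` on `|1⟩`. -/
def ladderBranch {I : Type*} [Fintype I] (γ : ℂ) (D : Matrix I I ℂ) (b : Fin 2) : Matrix I I ℂ :=
  if b = 0 then Dᴴ else γ • ((D + Dᴴ) * D)

theorem sum_ladderBranch {I : Type*} [Fintype I] [DecidableEq I] {γ : ℂ} (hγ : star γ * γ = 1)
    {D : Matrix I I ℂ} (hD : IsLadder D) :
    ∑ b, (ladderBranch γ D b)ᴴ * ladderBranch γ D b = 1 := by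
  have hA : (Dᴴ + D) * (D + Dᴴ) = 1 := by
    have : (Dᴴ + D) * (D + Dᴴ) = (D * Dᴴ + Dᴴ * D) + (D * D + Dᴴ * Dᴴ) := by noncomm_ring
    rw [this, hD.mul_add_mul, hD.sq_add_sq, add_zero]
  have h1 : (ladderBranch γ D 1)ᴴ * ladderBranch γ D 1 = Dᴴ * D := by
    simp only [ladderBranch, one_ne_zero, if_false, conjTranspose_smul, conjTranspose_mul,
      conjTranspose_add, conjTranspose_conjTranspose, smul_mul_smul_comm, hγ, one_smul]
    rw [mul_assoc, ← mul_assoc _ _ D, hA, one_mul]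
  rw [Fin.sum_univ_two, h1]
  simp [ladderBranch, hD.mul_add_mul]

theorem vecNormSq_conjTranspose_mulVec (hD : ∀ j, IsLadder (D j)) (hij : i ≠ j)
    (hω : star ω * ω = 1) (hψ : vecNormSq ψ = 1)
    (hmax : (ω * (star ψ ⬝ᵥ (piKronecker D *ᵥ ψ))).re = 1 / 2) :
    vecNormSq ((localOp i (D i))ᴴ *ᵥ ψ) = 1 / 2 := by
  have h := (saturation hD hij hω hψ hmax).1
  rw [vecNormSq]
  nth_rewrite 2 [h]
  rw [star_mulVec_dotProduct, conjTranspose_conjTranspose, mulVec_smul, dotProduct_smul,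
    mulVec_mulVec, mulVec_mulVec, localOp_mul_restOp_mul hij, smul_eq_mul, hmax]

theorem mulVec_conjTranspose_mulVec_eq_zero (hD : ∀ j, IsLadder (D j)) (hij : i ≠ j)
    (hω : star ω * ω = 1) (hωI : ω * ω = Complex.I) (hψ : vecNormSq ψ = 1)
    (hmax : (ω * (star ψ ⬝ᵥ (piKronecker D *ᵥ ψ))).re = 1 / 2) :
    localOp j (D j) *ᵥ (localOp i (D i))ᴴ *ᵥ ψ = 0 := by
  rw [mulVec_mulVec, localOp_conjTranspose, ← localOp_comm hij, ← localOp_conjTranspose,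
    ← mulVec_mulVec, conjTranspose_mulVec_mulVec_eq_zero hD hij hω hωI hψ hmax]

theorem conjTranspose_sq_mulVec_eq_zero (hD : ∀ j, IsLadder (D j)) (hij : i ≠ j)
    (hω : star ω * ω = 1) (hωI : ω * ω = Complex.I) (hψ : vecNormSq ψ = 1)
    (hmax : (ω * (star ψ ⬝ᵥ (piKronecker D *ᵥ ψ))).re = 1 / 2) :
    (localOp i (D i))ᴴ *ᵥ (localOp i (D i))ᴴ *ᵥ ψ = 0 := by
  rw [(saturation hD hij hω hψ hmax).1, mulVec_smul, mulVec_mulVec, localOp_conjTranspose,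
    localOp_comm_restOp_left, ← mulVec_mulVec, ← localOp_conjTranspose,
    conjTranspose_mulVec_mulVec_eq_zero hD hij hω hωI hψ hmax, mulVec_zero, smul_zero]

theorem vecNormSq_piKronecker_conjTranspose (hD : ∀ j, IsLadder (D j)) (hij : i ≠ j)
    (hω : star ω * ω = 1) (hωI : ω * ω = Complex.I) (hψ : vecNormSq ψ = 1)
    (hmax : (ω * (star ψ ⬝ᵥ (piKronecker D *ᵥ ψ))).re = 1 / 2) :
    vecNormSq (piKronecker (fun j => (D j)ᴴ) *ᵥ ψ) = 1 / 2 := by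
  rw [piKronecker_eq_mul_localOp i, ← mulVec_mulVec, ← localOp_conjTranspose,
    ← vecNormSq_conjTranspose_mulVec hD hij hω hψ hmax, vecNormSq_mulVec, vecNormSq,
    piKronecker_conjTranspose, piKronecker_mul, piKronecker_mulVec_congr _ 1, piKronecker_one,
    one_mulVec]
  intro l
  rcases eq_or_ne l i with rfl | h
  · simp
  · simp only [Function.update_of_ne h, conjTranspose_conjTranspose, Pi.one_apply, localOp_one,
      one_mulVec]
    rw [← localOp_mul, ← localOp_conjTranspose, ← mulVec_mulVec]
    have := (isLadder_localOp l (hD l)).conjTranspose.conjTranspose_mul_self_mulVec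
      (v := (localOp i (D i))ᴴ *ᵥ ψ)
    rw [conjTranspose_conjTranspose] at this
    exact this (mulVec_conjTranspose_mulVec_eq_zero hD h.symm hω hωI hψ hmax)

/-- The branches of the isometries that are constantly `|0⟩` and constantly `|1⟩` agree up to
the phase `ω`. -/
theorem piKronecker_conjTranspose_mulVec_eq (hD : ∀ j, IsLadder (D j)) (hij : i ≠ j)
    (hω : star ω * ω = 1) (hωI : ω * ω = Complex.I) (hψ : vecNormSq ψ = 1)
    (hmax : (ω * (star ψ ⬝ᵥ (piKronecker D *ᵥ ψ))).re = 1 / 2) :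
    piKronecker (fun j => (D j)ᴴ) *ᵥ ψ
      = ω • piKronecker (fun j => (D j + (D j)ᴴ) * D j) *ᵥ ψ := by
  have hpartner : ∀ l, ∃ l', l ≠ l' := fun l => by
    rcases eq_or_ne l i with rfl | h
    · exact ⟨j, hij⟩
    · exact ⟨i, h⟩
  have h1 : piKronecker (fun j => (D j + (D j)ᴴ) * D j) *ᵥ ψ
      = piKronecker (fun j => (D j)ᴴ * D j) *ᵥ ψ := by
    refine piKronecker_mulVec_congr _ _ _ fun l => ?_
    obtain ⟨l', hl⟩ := hpartner l
    have := (isLadder_localOp l (hD l)).mulVec_sq_eq_zero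
      (conjTranspose_sq_mulVec_eq_zero hD hl hω hωI hψ hmax)
    rw [add_mul, localOp_add, add_mulVec, ← localOp_mul, ← mulVec_mulVec, this, zero_add]
  have h2 : ω • piKronecker (fun j => (D j)ᴴ * D j) *ᵥ ψ
      = localOp i ((D i)ᴴ * D i) *ᵥ piKronecker (fun j => (D j)ᴴ) *ᵥ ψ := by
    have hsplit : piKronecker (fun j => (D j)ᴴ * D j) = localOp i ((D i)ᴴ * D i) *
        (piKronecker (Function.update (fun j => (D j)ᴴ) i 1) *
          (restOp D i j * localOp j (D j))) := by
      rw [piKronecker_eq_localOp_mul i (fun j => (D j)ᴴ * D j)]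
      have : restOp D i j * localOp j (D j) = piKronecker (Function.update D i 1) := by
        rw [piKronecker_eq_mul_localOp j (Function.update D i 1), Function.update_of_ne hij.symm,
          restOp]
      rw [this, piKronecker_mul]
      congr 2
      funext l
      rcases eq_or_ne l i with rfl | h
      · simp
      · simp [h]
    rw [hsplit, ← mulVec_mulVec, ← mulVec_mulVec, ← mulVec_mulVec, ← mulVec_smul, ← mulVec_smul,
      ← (saturation hD hij hω hψ hmax).1, localOp_conjTranspose, mulVec_mulVec _ (piKronecker _),
      ← piKronecker_eq_mul_localOp i (fun j => (D j)ᴴ)]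
  rw [h1, h2, ← localOp_mul, ← mulVec_mulVec, ← localOp_conjTranspose,
    (isLadder_localOp i (hD i)).conjTranspose_mul_self_mulVec]
  rw [piKronecker_eq_mul_localOp i, mulVec_mulVec, ← mul_assoc, localOp_conjTranspose,
    localOp_comm_piKronecker i _ (by simp), mul_assoc, ← mulVec_mulVec, ← mulVec_mulVec,
    ← localOp_conjTranspose, conjTranspose_sq_mulVec_eq_zero hD hij hω hωI hψ hmax, mulVec_zero]

theorem piKronecker_ladderBranch_eq_zero (hD : ∀ j, IsLadder (D j)) (hij : i ≠ j)
    (hω : star ω * ω = 1) (hωI : ω * ω = Complex.I) (hψ : vecNormSq ψ = 1)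
    (hmax : (ω * (star ψ ⬝ᵥ (piKronecker D *ᵥ ψ))).re = 1 / 2) (γ : ℂ) {b : ι → Fin 2}
    (hi : b i = 0) (hj : b j = 1) :
    piKronecker (fun l => ladderBranch γ (D l) (b l)) *ᵥ ψ = 0 := by
  have h1 : localOp j (γ • ((D j + (D j)ᴴ) * D j))
      = localOp j (γ • (D j + (D j)ᴴ)) * localOp j (D j) := by
    rw [localOp_mul, smul_mul_assoc]
  rw [piKronecker_eq_mul_localOp j, piKronecker_eq_mul_localOp i]
  simp only [Function.update_of_ne hij, ladderBranch, hi, hj, if_true, one_ne_zero, if_false]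
  rw [h1, mul_assoc, ← mul_assoc (localOp i _), localOp_comm hij, mul_assoc (localOp j _),
    ← mulVec_mulVec, ← mulVec_mulVec, ← mulVec_mulVec, ← localOp_conjTranspose,
    conjTranspose_mulVec_mulVec_eq_zero hD hij hω hωI hψ hmax, mulVec_zero, mulVec_zero]

/-- A state saturating the ladder inequality is a GHZ state up to the isometries given by
`ladderBranch`. -/
theorem piKronecker_ladderBranch_mulVec (hD : ∀ j, IsLadder (D j)) (hij : i ≠ j)
    (hω : star ω * ω = 1) (hωI : ω * ω = Complex.I) (hψ : vecNormSq ψ = 1)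
    (hmax : (ω * (star ψ ⬝ᵥ (piKronecker D *ᵥ ψ))).re = 1 / 2) {γ : ℂ}
    (hγ : γ ^ Fintype.card ι = ω) (b : ι → Fin 2) :
    piKronecker (fun l => ladderBranch γ (D l) (b l)) *ᵥ ψ
      = ghzVec b • ((Real.sqrt 2 : ℂ) • piKronecker (fun l => (D l)ᴴ) *ᵥ ψ) := by
  have h2 : (Real.sqrt 2 : ℂ) ≠ 0 := by simp
  have h01 : (fun _ : ι => (0 : Fin 2)) ≠ fun _ => 1 := fun h => by simpa using congrFun h i
  by_cases hb0 : b = fun _ => 0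
  · subst hb0
    have hg : (ghzVec fun _ : ι => (0 : Fin 2)) = (Real.sqrt 2 : ℂ)⁻¹ := by simp [ghzVec, h01]
    rw [hg, smul_smul, inv_mul_cancel₀ h2, one_smul]
    simp [ladderBranch]
  by_cases hb1 : b = fun _ => 1
  · subst hb1
    rw [piKronecker_conjTranspose_mulVec_eq hD hij hω hωI hψ hmax]
    simp [ghzVec, ladderBranch, h01.symm, smul_smul, h2, piKronecker_smul, hγ, smul_mulVec]
  · have h0 : ghzVec b = 0 := by simp [ghzVec, hb0, hb1]
    obtain ⟨l1, hl1⟩ := Function.ne_iff.mp hb0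
    obtain ⟨l0, hl0⟩ := Function.ne_iff.mp hb1
    have hl1' : b l1 = 1 := by omega
    have hl0' : b l0 = 0 := by omega
    have hne : l0 ≠ l1 := by
      rintro rfl
      exact hl1 hl0'
    rw [piKronecker_ladderBranch_eq_zero hD hne hω hωI hψ hmax γ hl0' hl1', h0, zero_smul]

end SelfTest

section Svetlichny

theorem neg_one_pow_triangular (w : ℕ) :
    (-1 : ℂ) ^ (w * (w + 1) / 2) = (((1 + Complex.I) * Complex.I ^ w).re : ℂ) := by
  obtain ⟨q, r, hr, rfl⟩ : ∃ q r, r < 4 ∧ w = 4 * q + r :=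
    ⟨w / 4, w % 4, Nat.mod_lt _ (by norm_num), (Nat.div_add_mod w 4).symm⟩
  have hI : Complex.I ^ (4 * q + r) = Complex.I ^ r := by
    rw [pow_add, pow_mul, Complex.I_pow_four, one_pow, one_mul]
  rw [hI]
  interval_cases r
  · have : (4 * q + 0) * (4 * q + 0 + 1) / 2 = 2 * (q * (4 * q + 1)) :=
      Nat.div_eq_of_eq_mul_left (by norm_num) (by ring)
    rw [this, pow_mul]
    simp
  · have : (4 * q + 1) * (4 * q + 1 + 1) / 2 = 2 * (4 * q * q + 3 * q) + 1 :=
      Nat.div_eq_of_eq_mul_left (by norm_num) (by ring)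
    rw [this, pow_succ, pow_mul]
    simp
  · have : (4 * q + 2) * (4 * q + 2 + 1) / 2 = 2 * (4 * q * q + 5 * q + 1) + 1 :=
      Nat.div_eq_of_eq_mul_left (by norm_num) (by ring)
    rw [this, pow_succ, pow_mul]
    simp
  · have : (4 * q + 3) * (4 * q + 3 + 1) / 2 = 2 * ((4 * q + 3) * (q + 1)) :=
      Nat.div_eq_of_eq_mul_left (by norm_num) (by ring)
    rw [this, pow_mul]
    simp [pow_succ]

theorem isLadder_of_even_odd {I : Type*} [Fintype I] [DecidableEq I] {A C : Matrix I I ℂ}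
    (hA : A.IsHermitian) (hA2 : A * A = 1) (hC : C.IsHermitian) (hC2 : C * C = 1) {w v : ℕ}
    (hw : Even w) (hv : ¬ Even v) :
    IsLadder ((1 / 2 : ℂ) • (Complex.I ^ w • A + Complex.I ^ v • C)) := by
  obtain ⟨r, rfl⟩ := even_iff_two_dvd.mp hw
  obtain ⟨t, rfl⟩ := Nat.not_even_iff_odd.mp hv
  set X := Complex.I ^ (2 * r) • A with hXdef
  set Y := Complex.I ^ (2 * t + 1) • C with hYdef
  have hX : Xᴴ = X := by
    rw [hXdef, conjTranspose_smul, hA.eq]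
    simp [pow_mul]
  have hY : Yᴴ = -Y := by
    rw [hYdef, conjTranspose_smul, hC.eq, ← neg_smul]
    simp [pow_mul, pow_succ]
  have hX2 : X * X = 1 := by
    rw [hXdef, smul_mul_smul_comm, hA2, pow_mul, Complex.I_sq, ← mul_pow]
    simp
  have hY2 : Y * Y = -1 := by
    rw [hYdef, smul_mul_smul_comm, hC2, pow_succ, pow_mul, Complex.I_sq,
      mul_mul_mul_comm, ← mul_pow]
    simp
  have hD : ((1 / 2 : ℂ) • (X + Y))ᴴ = (1 / 2 : ℂ) • (X - Y) := by
    rw [conjTranspose_smul, conjTranspose_add, hX, hY, ← sub_eq_add_neg]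
    simp
  constructor
  · rw [hD, smul_mul_smul_comm, smul_mul_smul_comm, ← smul_add]
    have : (X + Y) * (X - Y) + (X - Y) * (X + Y) = (2 : ℂ) • (X * X - Y * Y) := by
      rw [two_smul]
      noncomm_ring
    rw [this, hX2, hY2, sub_neg_eq_add, ← two_smul ℂ (1 : Matrix I I ℂ), smul_smul, smul_smul]
    norm_num
  · rw [hD, smul_mul_smul_comm, smul_mul_smul_comm, ← smul_add]
    have : (X + Y) * (X + Y) + (X - Y) * (X - Y) = (2 : ℂ) • (X * X + Y * Y) := by
      rw [two_smul]
      noncomm_ring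
    rw [this, hX2, hY2]
    simp

theorem even_sum_flip {S : Type*} [Fintype S] [DecidableEq S] (u : S → Fin 2) (s : S) :
    Even (∑ i, ((u i + if i = s then 1 else 0 : Fin 2) : ℕ)) ↔ ¬ Even (∑ i, (u i : ℕ)) := by
  rw [← Finset.add_sum_erase _ _ (Finset.mem_univ s),
    ← Finset.add_sum_erase _ (fun i => (u i : ℕ)) (Finset.mem_univ s)]
  have : ∑ i ∈ Finset.univ.erase s, ((u i + if i = s then 1 else 0 : Fin 2) : ℕ)
      = ∑ i ∈ Finset.univ.erase s, (u i : ℕ) :=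
    Finset.sum_congr rfl fun i hi => by simp [Finset.ne_of_mem_erase hi]
  rw [this, if_pos rfl, Nat.even_add, Nat.even_add]
  generalize u s = a
  fin_cases a <;> simp

variable {N k : ℕ} {B : Fin N → Fin k} {d : Fin k → ℕ}

/-- The expectation value of the product observable measured on the input string `x`. -/
def corr (B : Fin N → Fin k)
    (M : (j : Fin k) → (({ i // B i = j }) → Fin 2) → Matrix (Fin (d j)) (Fin (d j)) ℂ)
    (ψ : ((j : Fin k) → Fin (d j)) → ℂ) (x : Fin N → Fin 2) : ℂ :=
  star ψ ⬝ᵥ (piKronecker (fun j => M j (fun i => x i.1)) *ᵥ ψ)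

theorem corr_re
    {M : (j : Fin k) → (({ i // B i = j }) → Fin 2) → Matrix (Fin (d j)) (Fin (d j)) ℂ}
    (hM : ∀ j u, (M j u).IsHermitian) (ψ : ((j : Fin k) → Fin (d j)) → ℂ) (x : Fin N → Fin 2) :
    ((corr B M ψ x).re : ℂ) = corr B M ψ x := by
  rw [← Complex.conj_eq_iff_re, ← Complex.star_def, corr]
  nth_rewrite 1 [star_dotProduct]
  rw [star_star, star_mulVec_dotProduct, piKronecker_conjTranspose]
  simp only [(hM _ _).eq]

theorem svetOpCluster_expectation
    {M : (j : Fin k) → (({ i // B i = j }) → Fin 2) → Matrix (Fin (d j)) (Fin (d j)) ℂ}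
    (hM : ∀ j u, (M j u).IsHermitian) (ψ : ((j : Fin k) → Fin (d j)) → ℂ) :
    (star ψ ⬝ᵥ (svetOpCluster B M *ᵥ ψ)).re
      = ∑ x : Fin N → Fin 2, ((1 + Complex.I) * Complex.I ^ wt x * corr B M ψ x).re := by
  have : star ψ ⬝ᵥ (svetOpCluster B M *ᵥ ψ) = ∑ x : Fin N → Fin 2, sgn x * corr B M ψ x := by
    rw [svetOpCluster, sum_mulVec, dotProduct_sum]
    refine Finset.sum_congr rfl fun x _ => ?_
    rw [smul_mulVec, dotProduct_smul, smul_eq_mul, corr, piKronecker]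
  rw [this, Complex.re_sum]
  refine Finset.sum_congr rfl fun x _ => ?_
  rw [sgn, neg_one_pow_triangular, ← corr_re hM, Complex.re_ofReal_mul, Complex.re_mul_ofReal,
    Complex.ofReal_re]

/-- The input of cluster `j` when the cluster input of `x` is shifted by `b` at party `σ j`. -/
def shiftInput (B : Fin N → Fin k) (σ : Fin k → Fin N) (x : Fin N → Fin 2) (j : Fin k)
    (b : Fin 2) : { i // B i = j } → Fin 2 :=
  fun i => x i.1 + if i.1 = σ j then b else 0

/-- The ladder operator of cluster `j` built from two inputs that differ only at party `σ j`. -/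
def clusterLadder (σ : Fin k → Fin N)
    (M : (j : Fin k) → (({ i // B i = j }) → Fin 2) → Matrix (Fin (d j)) (Fin (d j)) ℂ)
    (x : Fin N → Fin 2) (j : Fin k) : Matrix (Fin (d j)) (Fin (d j)) ℂ :=
  (1 / 2 : ℂ) • ∑ b, Complex.I ^ (∑ i, (shiftInput B σ x j b i : ℕ)) • M j (shiftInput B σ x j b)

theorem isLadder_clusterLadder {σ : Fin k → Fin N} (hσ : ∀ j, B (σ j) = j)
    {M : (j : Fin k) → (({ i // B i = j }) → Fin 2) → Matrix (Fin (d j)) (Fin (d j)) ℂ}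
    (hM : ∀ j u, (M j u).IsHermitian) (hM2 : ∀ j u, M j u * M j u = 1)
    (x : Fin N → Fin 2) (j : Fin k) : IsLadder (clusterLadder σ M x j) := by
  have hpar : Even (∑ i, (shiftInput B σ x j 1 i : ℕ))
      ↔ ¬ Even (∑ i, (shiftInput B σ x j 0 i : ℕ)) := by
    have := even_sum_flip (fun i : { i // B i = j } => x i.1) ⟨σ j, hσ j⟩
    simpa [shiftInput, Subtype.ext_iff] using this
  rw [clusterLadder, Fin.sum_univ_two]
  by_cases h : Even (∑ i, (shiftInput B σ x j 0 i : ℕ))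
  · exact isLadder_of_even_odd (hM _ _) (hM2 _ _) (hM _ _) (hM2 _ _) h fun h1 => hpar.mp h1 h
  · rw [add_comm]
    exact isLadder_of_even_odd (hM _ _) (hM2 _ _) (hM _ _) (hM2 _ _) (hpar.mpr h) h

/-- The shift of an input string by `z j` at party `σ j`, for every cluster `j`. -/
def shiftString (B : Fin N → Fin k) (σ : Fin k → Fin N) (z : Fin k → Fin 2) : Fin N → Fin 2 :=
  fun i => if i = σ (B i) then z (B i) else 0

theorem restrict_add_shiftString (σ : Fin k → Fin N) (x : Fin N → Fin 2) (z : Fin k → Fin 2)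
    (j : Fin k) :
    (fun i : { i // B i = j } => (x + shiftString B σ z) i.1) = shiftInput B σ x j (z j) := by
  funext ⟨i, hi⟩
  subst hi
  rfl

theorem I_pow_wt (B : Fin N → Fin k) (x : Fin N → Fin 2) :
    Complex.I ^ wt x = ∏ j, Complex.I ^ (∑ i : { i // B i = j }, (x i.1 : ℕ)) := by
  rw [Finset.prod_pow_eq_pow_sum, wt, Fintype.sum_fiberwise B fun i => (x i : ℕ)]

theorem sum_shift_corr (σ : Fin k → Fin N)
    (M : (j : Fin k) → (({ i // B i = j }) → Fin 2) → Matrix (Fin (d j)) (Fin (d j)) ℂ)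
    (ψ : ((j : Fin k) → Fin (d j)) → ℂ) (x : Fin N → Fin 2) :
    ∑ z : Fin k → Fin 2, Complex.I ^ wt (x + shiftString B σ z) *
        corr B M ψ (x + shiftString B σ z)
      = 2 ^ k * (star ψ ⬝ᵥ (piKronecker (clusterLadder σ M x) *ᵥ ψ)) := by
  have h : piKronecker (clusterLadder σ M x) = (1 / 2 : ℂ) ^ k • ∑ z : Fin k → Fin 2,
      Complex.I ^ wt (x + shiftString B σ z) •
        piKronecker (fun j => M j (fun i => (x + shiftString B σ z) i.1)) := by
    unfold clusterLadder
    rw [piKronecker_smul, piKronecker_sum, Finset.prod_const, Finset.card_univ, Fintype.card_fin]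
    congr 1
    refine Finset.sum_congr rfl fun z _ => ?_
    rw [piKronecker_smul, I_pow_wt B]
    congr 1
    · exact Finset.prod_congr rfl fun j _ => by rw [← restrict_add_shiftString]
    · congr 1
      funext j
      rw [← restrict_add_shiftString]
  rw [h, smul_mulVec, dotProduct_smul, smul_eq_mul, ← mul_assoc, ← mul_pow, sum_mulVec,
    dotProduct_sum]
  simp [smul_mulVec, corr]

/-- A state maximising the Svetlichny–Bell operator saturates the ladder inequality for the
two-input blocks obtained by letting only one party per cluster vary its input. -/
theorem clusterLadder_saturated (hN : 1 ≤ N) {i₀ j₀ : Fin k} (hij : i₀ ≠ j₀) {σ : Fin k → Fin N}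
    (hσ : ∀ j, B (σ j) = j)
    {M : (j : Fin k) → (({ i // B i = j }) → Fin 2) → Matrix (Fin (d j)) (Fin (d j)) ℂ}
    (hM : ∀ j u, (M j u).IsHermitian) (hM2 : ∀ j u, M j u * M j u = 1)
    {ψ : ((j : Fin k) → Fin (d j)) → ℂ} (hψ : vecNormSq ψ = 1) {ω : ℂ}
    (hω : star ω * ω = 1) (hωI : 1 + Complex.I = (Real.sqrt 2 : ℂ) * ω)
    (hmax : (star ψ ⬝ᵥ (svetOpCluster B M *ᵥ ψ)).re = 2 ^ (N - 1) * Real.sqrt 2) :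
    (ω * (star ψ ⬝ᵥ (piKronecker (clusterLadder σ M 0) *ᵥ ψ))).re = 1 / 2 := by
  rw [svetOpCluster_expectation hM] at hmax
  set t : (Fin N → Fin 2) → ℝ :=
    fun x => (ω * (star ψ ⬝ᵥ (piKronecker (clusterLadder σ M x) *ᵥ ψ))).re with ht
  set f : (Fin N → Fin 2) → ℝ :=
    fun x => ((1 + Complex.I) * Complex.I ^ wt x * corr B M ψ x).re with hf
  have hle : ∀ x ∈ Finset.univ, t x ≤ 1 / 2 := fun x _ =>
    re_piKronecker_le (isLadder_clusterLadder hσ hM hM2 x) hij hω hψ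
  have hblock : ∀ x, ∑ z, f (x + shiftString B σ z) = 2 ^ k * Real.sqrt 2 * t x := by
    intro x
    simp only [hf, ht, ← Complex.re_sum, mul_assoc, ← Finset.mul_sum]
    rw [sum_shift_corr, hωI, ← Complex.re_ofReal_mul, ← Complex.re_ofReal_mul]
    congr 1
    push_cast
    ring
  have hsum : 2 ^ k * Real.sqrt 2 * ∑ x, t x = 2 ^ k * (2 ^ (N - 1) * Real.sqrt 2) := by
    rw [Finset.mul_sum, ← Finset.sum_congr rfl fun x _ => hblock x, Finset.sum_comm, ← hmax]
    have : ∀ z, ∑ x, f (x + shiftString B σ z) = ∑ x, f x := fun z =>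
      Equiv.sum_comp (Equiv.addRight (shiftString B σ z)) f
    simp [this]
  have htot : ∑ x, t x = ∑ _x : Fin N → Fin 2, (1 / 2 : ℝ) := by
    have h3 : ∑ x, t x = 2 ^ (N - 1) := by
      have : (2 ^ k * Real.sqrt 2) * ∑ x, t x = (2 ^ k * Real.sqrt 2) * 2 ^ (N - 1) := by
        rw [hsum]
        ring
      exact mul_left_cancel₀ (by positivity) this
    obtain ⟨N', rfl⟩ := Nat.exists_eq_add_of_le' hN
    rw [h3]
    simp [pow_succ]
  exact (Finset.sum_eq_sum_iff_of_le hle).mp htot 0 (Finset.mem_univ _)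

end Svetlichny

/-- Cluster self-testing theorem: if the `N` parties are partitioned into `k ≥ 2` nonempty
collaborating clusters (cluster assignment `B`, surjective), each cluster holding joint
binary observables `M^{(j)}_u`, then any unit state maximally violating `Ŝ_N^+` is mapped by
one isometry per cluster to the `k`-partite GHZ state tensored with uncorrelated degrees of
freedom. -/
theorem stmt_19 (N k : ℕ) (hN : 2 ≤ N) (hk : 2 ≤ k)
    (B : Fin N → Fin k) (hB : Function.Surjective B) (d : Fin k → ℕ)
    (M : (j : Fin k) → (({ i // B i = j }) → Fin 2) → Matrix (Fin (d j)) (Fin (d j)) ℂ)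
    (hMherm : ∀ j u, (M j u).IsHermitian) (hMsq : ∀ j u, M j u * M j u = 1)
    (ψ : ((j : Fin k) → Fin (d j)) → ℂ) (hψ : (∑ x, ‖ψ x‖ ^ 2) = 1)
    (hmax : ∑ p, (starRingEnd ℂ) (ψ p) * (svetOpCluster B M).mulVec ψ p =
      ((2 ^ (N - 1) * Real.sqrt 2 : ℝ) : ℂ)) :
    ∃ (m : Fin k → ℕ) (V : (j : Fin k) → Matrix (Fin 2 × Fin (m j)) (Fin (d j)) ℂ)
      (ζ : ((j : Fin k) → Fin (m j)) → ℂ),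
      (∀ j, (V j)ᴴ * V j = 1) ∧ (∑ a, ‖ζ a‖ ^ 2) = 1 ∧
        ∀ f : (j : Fin k) → Fin 2 × Fin (m j),
          tensorIsoAct V ψ f = ghzVec (fun j => (f j).1) * ζ (fun j => (f j).2) := by
  obtain ⟨σ, hσ⟩ := hB.hasRightInverse
  have hij : (⟨0, by omega⟩ : Fin k) ≠ ⟨1, by omega⟩ := by simp
  have h2 : (Real.sqrt 2 : ℂ) ≠ 0 := by simp
  have h22 : (Real.sqrt 2 : ℂ) * (Real.sqrt 2 : ℂ) = 2 := by
    rw [← Complex.ofReal_mul, Real.mul_self_sqrt (by norm_num)]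
    simp
  obtain ⟨ω, hωdef⟩ : ∃ ω : ℂ, ω = (1 + Complex.I) / (Real.sqrt 2 : ℂ) := ⟨_, rfl⟩
  have hωs : 1 + Complex.I = (Real.sqrt 2 : ℂ) * ω := by
    rw [hωdef]
    field_simp
  have hω : star ω * ω = 1 := by
    rw [hωdef, Complex.star_def, map_div₀, Complex.conj_ofReal, div_mul_div_comm, h22]
    simp only [map_add, map_one, Complex.conj_I]
    linear_combination (-1 / 2 : ℂ) * Complex.I_mul_I
  have hωI : ω * ω = Complex.I := by
    rw [hωdef, div_mul_div_comm, h22]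
    linear_combination (1 / 2 : ℂ) * Complex.I_mul_I
  obtain ⟨γ, hγ⟩ := IsAlgClosed.exists_pow_nat_eq ω (show 0 < k by omega)
  have hγ1 : star γ * γ = 1 := by
    have hn : ‖ω‖ = 1 := by
      have := congrArg norm hω
      rw [norm_mul, norm_star, norm_one] at this
      nlinarith [norm_nonneg ω]
    have hg : ‖γ‖ = 1 := by
      rw [← hγ, norm_pow] at hn
      exact (pow_eq_one_iff_of_nonneg (norm_nonneg γ) (by omega)).mp hn
    rw [Complex.star_def, Complex.conj_mul', hg]
    simp
  have hψ' : vecNormSq ψ = 1 := by rw [vecNormSq_eq_sum, hψ]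
  have hmax' : (star ψ ⬝ᵥ (svetOpCluster B M *ᵥ ψ)).re = 2 ^ (N - 1) * Real.sqrt 2 := by
    have : star ψ ⬝ᵥ (svetOpCluster B M *ᵥ ψ) = ((2 ^ (N - 1) * Real.sqrt 2 : ℝ) : ℂ) := hmax
    rw [this, Complex.ofReal_re]
  have hD := isLadder_clusterLadder hσ hMherm hMsq 0
  have hsat := clusterLadder_saturated (by omega) hij hσ hMherm hMsq hψ' hω hωs hmax'
  set D := clusterLadder σ M 0
  refine ⟨d, fun j => Matrix.of fun p q => ladderBranch γ (D j) p.1 p.2 q,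
    (Real.sqrt 2 : ℂ) • piKronecker (fun l => (D l)ᴴ) *ᵥ ψ, fun j => ?_, ?_, fun f => ?_⟩
  · rw [← sum_ladderBranch hγ1 (hD j)]
    ext p q
    simp [Matrix.mul_apply, Fintype.sum_prod_type, Matrix.add_apply]
  · have := vecNormSq_piKronecker_conjTranspose hD hij hω hωI hψ' hsat
    rw [vecNormSq_eq_sum] at this
    simp only [Pi.smul_apply, smul_eq_mul, norm_mul, mul_pow, ← Finset.mul_sum]
    rw [this]
    simp
  · have := congrFun (piKronecker_ladderBranch_mulVec hD hij hω hωI hψ' hsat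
      (γ := γ) (by rw [Fintype.card_fin, hγ]) fun j => (f j).1) fun j => (f j).2
    exact this
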